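/- arXiv:math/0011185 — 2 statements merged into one kernel-verified Lean document; each statement's English description precedes it below -/
import Mathlib

section
/- Suppose λ = 2^μ = μ⁺ and for some regular cardinal κ < μ either (i) μ^κ = μ, or (ii) μ is singular with cf μ ≠ κ and |δ|^κ < μ for all cardinals δ < μ. Then the diamond principle ◊_λ(E_κ) holds, where E_κ = {α < λ : cf α = κ}. -/
open Cardinal

/-- `C` is closed unbounded in `lam`: `C ⊆ lam`, unbounded in `lam`, and closed
under suprema of its bounded nonempty subsets. -/
def IsClubIn (lam : Ordinal) (C : Set Ordinal) : Prop :=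
  C ⊆ Set.Iio lam ∧
  (∀ β : Ordinal, β < lam → ∃ γ ∈ C, β ≤ γ) ∧
  (∀ s : Set Ordinal, s ⊆ C → s.Nonempty → sSup s < lam → sSup s ∈ C)

/-- `E` is stationary in `lam`: it meets every closed unbounded subset of `lam`. -/
def IsStationaryIn (lam : Ordinal) (E : Set Ordinal) : Prop :=
  ∀ C : Set Ordinal, IsClubIn lam C → (E ∩ C).Nonempty

/-- The diamond principle ◊_lam(E): there is a family `Sfam ν ⊆ ν` (`ν ∈ E`) such
that for every `X ⊆ lam` the set `{ν ∈ E : X ∩ ν = Sfam ν}` is stationary in `lam`. -/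
def DiamondOn (lam : Ordinal) (E : Set Ordinal) : Prop :=
  ∃ Sfam : Ordinal → Set Ordinal,
    (∀ ν ∈ E, Sfam ν ⊆ Set.Iio ν) ∧
    ∀ X : Set Ordinal, X ⊆ Set.Iio lam →
      IsStationaryIn lam {ν | ν ∈ E ∧ X ∩ Set.Iio ν = Sfam ν}

section

universe u

theorem iSup_Iio_lt_ord {c : Cardinal.{u}} (hc : c.IsRegular) {o : Ordinal.{u}} (ho : o < c.ord)
    (F : Ordinal.{u} → Ordinal.{u}) (hF : ∀ b < o, F b < c.ord) :
    (⨆ b : Set.Iio o, F b) < c.ord := by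
  apply Ordinal.lift_iSup_lt_of_lt_cof
  · rw [Cardinal.mk_Iio_ordinal, ← Ordinal.lift_cof, hc.cof_ord, Cardinal.lift_lift]
    rw [Cardinal.lift_umax.{u, u+1}]
    exact Cardinal.lift_lt.2 (Cardinal.lt_ord.1 ho)
  · exact fun i => hF i i.2

/-- One step of the closing-off process. -/
noncomputable def closeStep (G : Ordinal.{u} → Ordinal.{u}) (x : Ordinal.{u}) : Ordinal.{u} :=
  max (x + 1) (⨆ b : Set.Iio (x + 1), (G b + 1))

/-- Iterating the closing-off process. -/
noncomputable def closeIter (G : Ordinal.{u} → Ordinal.{u}) (a : Ordinal.{u}) : Ordinal.{u} :=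
  ⨆ b : Set.Iio a, closeStep G (closeIter G b.1)
termination_by a
decreasing_by exact b.2

theorem closeStep_le_closeIter (G : Ordinal.{u} → Ordinal.{u}) {a b : Ordinal.{u}} (h : b < a) :
    closeStep G (closeIter G b) ≤ closeIter G a := by
  rw [closeIter.eq_1 G a]
  exact Ordinal.le_iSup (fun b : Set.Iio a => closeStep G (closeIter G b.1)) ⟨b, h⟩

theorem exists_closed {c κ : Cardinal.{u}} (hc : c.IsRegular) (hκ : κ.IsRegular) (hκc : κ < c)
    (G : Ordinal.{u} → Ordinal.{u}) (hG : ∀ a < c.ord, G a < c.ord) :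
    ∃ δ < c.ord, δ.cof = κ ∧ ∀ a < δ, G a < δ := by
  have hlim := Cardinal.isSuccLimit_ord hc.1
  have hstep : ∀ x < c.ord, closeStep G x < c.ord := by
    intro x hx
    have hx1 : x + 1 < c.ord := hlim.add_one_lt hx
    refine max_lt hx1 (iSup_Iio_lt_ord hc hx1 (fun b => G b + 1) ?_)
    intro b hb
    exact hlim.add_one_lt (hG b (hb.trans hx1))
  have hiter : ∀ a < c.ord, closeIter G a < c.ord := by
    intro a
    induction a using WellFoundedLT.induction with
    | ind a ih =>
      intro ha
      rw [closeIter]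
      exact iSup_Iio_lt_ord hc ha (fun b => closeStep G (closeIter G b))
        (fun b hb => hstep _ (ih b hb (hb.trans ha)))
  have hlt : ∀ x, x < closeStep G x := fun x =>
    lt_of_lt_of_le (Order.lt_add_one_iff.2 le_rfl) (le_max_left _ _)
  have hmono : StrictMono (closeIter G) := fun a b hab =>
    (hlt _).trans_le (closeStep_le_closeIter G hab)
  have hκlim := Cardinal.isSuccLimit_ord hκ.1
  have hκo : κ.ord < c.ord := Cardinal.ord_lt_ord.2 hκc
  refine ⟨⨆ b : Set.Iio κ.ord, closeIter G b, ?_, ?_, ?_⟩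
  · exact iSup_Iio_lt_ord hc hκo _ (fun b hb => hiter b (hb.trans hκo))
  · rw [Ordinal.cof_iSup_Iio (f := fun b : Set.Iio κ.ord => closeIter G b) ?_ hκlim.isSuccPrelimit,
      hκ.cof_ord]
    intro a b hab
    exact hmono hab
  · intro a ha
    obtain ⟨b, hb⟩ := Ordinal.lt_iSup_iff.1 ha
    have hb2 : b.1 + 1 < κ.ord := hκlim.add_one_lt b.2
    have h1 : G a + 1 ≤ closeStep G (closeIter G b) := by
      refine le_trans ?_ (le_max_right _ _)
      exact Ordinal.le_iSup (fun x : Set.Iio (closeIter G b + 1) => G x + 1)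
        ⟨a, hb.trans (Order.lt_add_one_iff.2 le_rfl)⟩
    calc G a < G a + 1 := Order.lt_add_one_iff.2 le_rfl
      _ ≤ closeStep G (closeIter G b) := h1
      _ ≤ closeIter G (b.1 + 1) := closeStep_le_closeIter G (Order.lt_add_one_iff.2 le_rfl)
      _ ≤ _ := Ordinal.le_iSup (fun b : Set.Iio κ.ord => closeIter G b) ⟨b.1 + 1, hb2⟩

/-- Enumeration of all bounded subsets of `lam × I`. -/
theorem exists_enum {μ lam : Cardinal.{u}} (hμ : ℵ₀ ≤ μ) (h1 : lam = 2 ^ μ)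
    (h2 : lam = Order.succ μ) (I : Type u) (hI : #I = μ) :
    ∃ A : Ordinal.{u} → Set (Ordinal.{u} × I), ∀ α < lam.ord, ∀ X : Set (Ordinal.{u} × I),
      (∀ p ∈ X, p.1 < α) → ∃ ξ < lam.ord, A ξ = X := by
  let T : Type u := Σ a : lam.ord.ToType, Set ((a.toOrd : Ordinal.{u}).ToType × I)
  have hlamω : ℵ₀ ≤ lam := h2 ▸ hμ.trans (Order.le_succ μ)
  have hT : #T ≤ #(lam.ord.ToType) := by
    rw [Cardinal.mk_sigma, Cardinal.mk_toType, Cardinal.card_ord]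
    calc _ ≤ Cardinal.sum (fun _ : lam.ord.ToType => lam) := by
          apply Cardinal.sum_le_sum
          intro a
          rw [Cardinal.mk_set]
          refine le_of_le_of_eq ?_ h1.symm
          apply Cardinal.power_le_power_left two_ne_zero
          rw [Cardinal.mk_prod, Cardinal.lift_id, Cardinal.lift_id, hI, Cardinal.mk_toType]
          have : ((a.toOrd : Ordinal.{u})).card ≤ μ := by
            rw [← Order.lt_succ_iff, ← h2]
            exact Cardinal.lt_ord.1 a.toOrd.2
          exact (mul_le_mul' this le_rfl).trans (Cardinal.mul_eq_self hμ).le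
      _ = lam := by
          rw [Cardinal.sum_const, Cardinal.mk_toType, Cardinal.card_ord,
            Cardinal.lift_id, Cardinal.mul_eq_self hlamω]
  obtain ⟨φ⟩ := hT
  let dec : T → Set (Ordinal.{u} × I) := fun t =>
    {p | ∃ h : p.1 < (t.1.toOrd : Ordinal.{u}), (Ordinal.ToType.mk ⟨p.1, h⟩, p.2) ∈ t.2}
  refine ⟨fun ξ => {p | ∃ t : T, ((φ t).toOrd : Ordinal.{u}) = ξ ∧ p ∈ dec t}, ?_⟩
  intro α hα X hX
  let a : lam.ord.ToType := Ordinal.ToType.mk ⟨α, hα⟩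
  have ha : (a.toOrd : Ordinal.{u}) = α := by simp [a]
  let t : T := ⟨a, {q | ((q.1.toOrd : Ordinal.{u}), q.2) ∈ X}⟩
  refine ⟨(φ t).toOrd, (φ t).toOrd.2, ?_⟩
  ext p
  constructor
  · rintro ⟨t2, ht2, h, hp⟩
    have : t2 = t := φ.injective (Ordinal.ToType.mk.symm.injective (Subtype.ext ht2))
    subst this
    simpa [t] using hp
  · intro hp
    refine ⟨t, rfl, ?_, ?_⟩
    · change p.1 < (a.toOrd : Ordinal.{u})
      rw [ha]; exact hX p hp
    · simpa [t] using hp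

/-- Covering lemma. -/
theorem exists_cover {μ κ : Cardinal.{u}} (hμ : ℵ₀ ≤ μ) (hκμ : κ < μ)
    (hcases : μ ^ κ = μ ∨
      (ℵ₀ ≤ μ ∧ μ.ord.cof < μ ∧ μ.ord.cof ≠ κ ∧
        ∀ d : Cardinal, d < μ → d ^ κ < μ))
    (K : Type u) (hK : #K = κ) (δ : Ordinal.{u}) (hδ : δ.cof = κ) (D : Type u) (hD : #D ≤ μ) :
    ∃ (J : Type u) (a : J → Set D), #J ≤ μ ∧ (∀ j, #(a j) ^ κ ≤ μ) ∧
      ∀ (f : K → Ordinal.{u}) (h : K → D), (∀ β < δ, ∃ k, β ≤ f k) →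
        ∃ j, ∀ β < δ, ∃ k, β ≤ f k ∧ h k ∈ a j := by
  rcases hcases with hc | ⟨-, hsing, hne, hpow⟩
  · refine ⟨PUnit, fun _ => Set.univ, ?_, ?_, ?_⟩
    · rw [Cardinal.mk_punit]
      exact Cardinal.one_le_aleph0.trans hμ
    · intro j
      rw [Cardinal.mk_univ]
      exact (Cardinal.power_le_power_right hD).trans hc.le
    · intro f h hf
      exact ⟨PUnit.unit, fun β hβ => (hf β hβ).imp fun k hk => ⟨hk, Set.mem_univ _⟩⟩
  · have hM : #μ.ord.ToType = μ := by rw [Cardinal.mk_toType, Cardinal.card_ord]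
    obtain ⟨e⟩ : #D ≤ #μ.ord.ToType := by rw [hM]; exact hD
    obtain ⟨S, hS, hScard⟩ := Order.exists_cof_eq μ.ord.ToType
    rw [Ordinal.cof_toType] at hScard
    refine ⟨S, fun s => {d | e d ≤ s.1}, hScard ▸ hsing.le, ?_, ?_⟩
    · intro s
      refine (hpow _ ?_).le
      have h1 : #{d | e d ≤ s.1} ≤ #(Set.Iic s.1) :=
        Cardinal.mk_le_of_injective (f := fun d => (⟨e d.1, d.2⟩ : Set.Iic s.1))
          (fun x y hxy => Subtype.ext (e.injective (congrArg Subtype.val hxy)))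
      refine h1.trans_lt ?_
      have := Cardinal.mk_Iic_lt s.1 (by rw [hM, Ordinal.type_toType]) (by rw [hM]; exact hμ)
      rwa [hM] at this
    · intro f h hf
      rcases lt_or_gt_of_ne hne with hlt | hlt
      · by_contra hcon
        push Not at hcon
        choose β hβ hβ2 using hcon
        have hsup : (⨆ s, β s) < δ :=
          Ordinal.iSup_lt_of_lt_cof (by rw [hScard, hδ]; exact hlt) hβ
        obtain ⟨k, hk⟩ := hf _ hsup
        obtain ⟨s, hs, hle⟩ := hS (e (h k))
        exact hβ2 ⟨s, hs⟩ k ((Ordinal.le_iSup β ⟨s, hs⟩).trans hk) hle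
      · have : ¬ IsCofinal (Set.range fun k => e (h k)) := by
          intro hcof
          have h1 := (Order.cof_le hcof).trans Cardinal.mk_range_le
          rw [Ordinal.cof_toType, hK] at h1
          exact absurd hlt h1.not_gt
        obtain ⟨m, hm⟩ := not_isCofinal_iff.1 this
        obtain ⟨s, hs, hle⟩ := hS m
        refine ⟨⟨s, hs⟩, fun β hβ => (hf β hβ).imp fun k hk => ⟨hk, ?_⟩⟩
        exact ((hm _ ⟨k, rfl⟩).le).trans hle

/-- A family of `μ` many candidate index sets below `δ`. -/
theorem exists_family {μ lam κ : Cardinal.{u}} (hμ : ℵ₀ ≤ μ) (hκμ : κ < μ) (hκ : κ ≠ 0)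
    (h2 : lam = Order.succ μ)
    (hcases : μ ^ κ = μ ∨
      (ℵ₀ ≤ μ ∧ μ.ord.cof < μ ∧ μ.ord.cof ≠ κ ∧
        ∀ d : Cardinal, d < μ → d ^ κ < μ))
    (I : Type u) (hI : #I = μ) (δ : Ordinal.{u}) (hδlam : δ < lam.ord) (hδ : δ.cof = κ) :
    ∃ T : I → Set Ordinal.{u}, ∀ g : Ordinal.{u} → Ordinal.{u}, (∀ β < δ, g β < δ) →
      ∃ i, ∃ Y : Set Ordinal.{u}, (∀ y ∈ Y, y < δ) ∧ (∀ β < δ, ∃ y ∈ Y, β ≤ y) ∧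
        T i = Set.image g Y := by
  have hδ0 : 0 < δ := Ordinal.cof_pos.1 (hδ ▸ pos_iff_ne_zero.2 hκ)
  have hD : #δ.ToType ≤ μ := by
    rw [Cardinal.mk_toType, ← Order.lt_succ_iff, ← h2]
    exact Cardinal.lt_ord.1 hδlam
  obtain ⟨K, hKcof, hK⟩ := Order.exists_cof_eq δ.ToType
  rw [Ordinal.cof_toType, hδ] at hK
  obtain ⟨J, a, hJ, ha, hcov⟩ := exists_cover hμ hκμ hcases K hK δ hδ δ.ToType hD
  have hT : #(Σ j, (K → a j)) ≤ #I := by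
    rw [Cardinal.mk_sigma, hI]
    calc _ ≤ Cardinal.sum (fun _ : J => μ) := by
          apply Cardinal.sum_le_sum
          intro j
          rw [← Cardinal.power_def, hK]
          exact ha j
      _ = #J * μ := by rw [Cardinal.sum_const, Cardinal.lift_id, Cardinal.lift_id]
      _ ≤ μ * μ := mul_le_mul' hJ le_rfl
      _ = μ := Cardinal.mul_eq_self hμ
  obtain ⟨φ⟩ := hT
  refine ⟨fun i => {x | ∃ t : Σ j, (K → a j), φ t = i ∧
    ∃ k, (((t.2 k).1.toOrd : Set.Iio δ) : Ordinal.{u}) = x}, ?_⟩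
  intro g hg
  let f : K → Ordinal.{u} := fun k => (k.1.toOrd : Set.Iio δ)
  have hfδ : ∀ k, f k < δ := fun k => (k.1.toOrd : Set.Iio δ).2
  have hf : ∀ β < δ, ∃ k, β ≤ f k := by
    intro β hβ
    obtain ⟨s, hs, hle⟩ := hKcof (Ordinal.ToType.mk ⟨β, hβ⟩)
    refine ⟨⟨s, hs⟩, ?_⟩
    have := Ordinal.ToType.mk.symm.monotone hle
    rw [OrderIso.symm_apply_apply] at this
    exact this
  let h : K → δ.ToType := fun k => Ordinal.ToType.mk ⟨g (f k), hg _ (hfδ k)⟩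
  have hh : ∀ k, (((h k).toOrd : Set.Iio δ) : Ordinal.{u}) = g (f k) := by
    intro k; simp [h]
  obtain ⟨j, hj⟩ := hcov f h hf
  obtain ⟨k0, -, hk0⟩ := hj 0 hδ0
  classical
  let t : Σ j, (K → a j) := ⟨j, fun k => if hk : h k ∈ a j then ⟨h k, hk⟩ else ⟨h k0, hk0⟩⟩
  refine ⟨φ t, Set.image f {k | h k ∈ a j}, ?_, ?_, ?_⟩
  · rintro _ ⟨k, -, rfl⟩
    exact hfδ k
  · intro β hβ
    obtain ⟨k, hk, hk2⟩ := hj β hβ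
    exact ⟨f k, ⟨k, hk2, rfl⟩, hk⟩
  · ext x
    constructor
    · rintro ⟨t2, ht2, k, rfl⟩
      have : t2 = t := φ.injective ht2
      subst this
      by_cases hk : h k ∈ a j
      · refine ⟨f k, ⟨k, hk, rfl⟩, ?_⟩
        simp only [t, dif_pos hk]
        exact (hh k).symm
      · refine ⟨f k0, ⟨k0, hk0, rfl⟩, ?_⟩
        simp only [t, dif_neg hk]
        exact (hh k0).symm
    · rintro ⟨_, ⟨k, hk, rfl⟩, rfl⟩
      refine ⟨t, rfl, k, ?_⟩
      have hk2 : h k ∈ a j := hk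
      simp only [t, dif_pos hk2]
      exact hh k

theorem diamond_aux
    (μ lam : Cardinal.{u}) (κ : Cardinal.{u}) (hκreg : κ.IsRegular) (hκμ : κ < μ)
    (hlam2 : lam = 2 ^ μ) (hlamsucc : lam = Order.succ μ)
    (hcases : μ ^ κ = μ ∨
      (ℵ₀ ≤ μ ∧ μ.ord.cof < μ ∧ μ.ord.cof ≠ κ ∧
        ∀ d : Cardinal, d < μ → d ^ κ < μ)) :
    DiamondOn lam.ord {α : Ordinal | α < lam.ord ∧ α.cof = κ} := by
  have hμ : ℵ₀ ≤ μ := hκreg.1.trans hκμ.le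
  have hreg : lam.IsRegular := hlamsucc ▸ Cardinal.isRegular_succ hμ
  have hμlam : μ < lam := hlamsucc ▸ Order.lt_succ μ
  have hlim := Cardinal.isSuccLimit_ord hreg.1
  let I : Type u := μ.out
  have hI : #I = μ := Cardinal.mk_out μ
  obtain ⟨A, hA⟩ := exists_enum hμ hlam2 hlamsucc I hI
  have hfam : ∀ δ : Ordinal.{u}, ∃ T : I → Set Ordinal.{u}, δ < lam.ord → δ.cof = κ →
      ∀ g : Ordinal.{u} → Ordinal.{u}, (∀ β < δ, g β < δ) →
      ∃ i, ∃ Y : Set Ordinal.{u}, (∀ y ∈ Y, y < δ) ∧ (∀ β < δ, ∃ y ∈ Y, β ≤ y) ∧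
        T i = Set.image g Y := by
    intro δ
    by_cases hδ : δ < lam.ord ∧ δ.cof = κ
    · obtain ⟨T, hT⟩ := exists_family hμ hκμ hκreg.ne_zero hlamsucc hcases I hI δ hδ.1 hδ.2
      exact ⟨T, fun _ _ => hT⟩
    · exact ⟨fun _ => ∅, fun h1 h2 => absurd ⟨h1, h2⟩ hδ⟩
  choose T hT using hfam
  let S : I → Ordinal.{u} → Set Ordinal.{u} := fun i δ =>
    {ξ | ξ < δ ∧ ∃ η ∈ T δ i, (ξ, i) ∈ A η}
  by_contra hcon
  have hbad : ∀ i : I, ∃ X : Set Ordinal.{u}, ∃ C : Set Ordinal.{u}, IsClubIn lam.ord C ∧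
      ∀ δ ∈ C, δ < lam.ord → δ.cof = κ → X ∩ Set.Iio δ ≠ S i δ := by
    intro i
    by_contra hno
    push Not at hno
    apply hcon
    refine ⟨S i, fun ν _ ξ hξ => hξ.1, ?_⟩
    intro X _ C hC
    obtain ⟨δ, h1, h2, h3, h4⟩ := hno X C hC
    exact ⟨δ, ⟨⟨h2, h3⟩, h4⟩, h1⟩
  choose X C hC hXC using hbad
  let XX : Set (Ordinal.{u} × I) := {p | p.1 ∈ X p.2}
  have hg : ∀ α : Ordinal.{u}, ∃ ξ : Ordinal.{u}, α < lam.ord →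
      ξ < lam.ord ∧ A ξ = {p | p ∈ XX ∧ p.1 < α} := by
    intro α
    by_cases hα : α < lam.ord
    · obtain ⟨ξ, h1, h2⟩ := hA α hα {p | p ∈ XX ∧ p.1 < α} (fun p hp => hp.2)
      exact ⟨ξ, fun _ => ⟨h1, h2⟩⟩
    · exact ⟨0, fun h => absurd h hα⟩
  choose g hg using hg
  have hnx : ∀ (i : I) (α : Ordinal.{u}), ∃ γ : Ordinal.{u}, α < lam.ord → γ ∈ C i ∧ α < γ := by
    intro i α
    by_cases hα : α < lam.ord
    · obtain ⟨γ, h1, h2⟩ := (hC i).2.1 (α + 1) (hlim.add_one_lt hα)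
      exact ⟨γ, fun _ => ⟨h1, (Order.lt_add_one_iff.2 le_rfl).trans_le h2⟩⟩
    · exact ⟨0, fun h => absurd h hα⟩
  choose nx hnx using hnx
  obtain ⟨δ, hδlam, hδcof, hδ⟩ := exists_closed hreg hκreg (hκμ.trans hμlam)
    (fun α => max (g α) (⨆ i, nx i α)) (by
      intro α hα
      refine max_lt (hg α hα).1 (Ordinal.iSup_lt_of_lt_cof ?_ ?_)
      · rw [hreg.cof_ord, hI]; exact hμlam
      · exact fun i => (hC i).1 (hnx i α hα).1)
  have hδ0 : 0 < δ := Ordinal.cof_pos.1 (hδcof ▸ hκreg.pos)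
  have hgδ : ∀ β < δ, g β < δ := fun β hβ => (le_max_left _ _).trans_lt (hδ β hβ)
  have hnδ : ∀ i, ∀ β < δ, nx i β < δ := fun i β hβ =>
    ((Ordinal.le_iSup (fun i => nx i β) i).trans (le_max_right _ _)).trans_lt (hδ β hβ)
  have hδC : ∀ i, δ ∈ C i := by
    intro i
    have hbdd : BddAbove (C i ∩ Set.Iio δ) := ⟨δ, fun x hx => hx.2.le⟩
    have hne : (C i ∩ Set.Iio δ).Nonempty :=
      ⟨nx i 0, (hnx i 0 (hδ0.trans hδlam)).1, hnδ i 0 hδ0⟩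
    have hle : sSup (C i ∩ Set.Iio δ) ≤ δ := csSup_le hne fun x hx => hx.2.le
    have heq : sSup (C i ∩ Set.Iio δ) = δ := by
      refine hle.antisymm (not_lt.1 fun hlt => ?_)
      have h1 := hnx i _ (hlt.trans hδlam)
      exact absurd (le_csSup hbdd ⟨h1.1, hnδ i _ hlt⟩) h1.2.not_ge
    have := (hC i).2.2 (C i ∩ Set.Iio δ) Set.inter_subset_left hne (heq.trans_lt hδlam)
    rwa [heq] at this
  obtain ⟨i, Y, hY1, hY2, hTY⟩ := hT δ hδlam hδcof g hgδ
  refine hXC i δ (hδC i) hδlam hδcof ?_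
  have hδlim : Order.IsSuccLimit δ := Ordinal.one_lt_cof_iff.1
    (hδcof ▸ Cardinal.one_lt_aleph0.trans_le hκreg.1)
  ext ξ
  constructor
  · rintro ⟨hξ, hξδ⟩
    obtain ⟨y, hy, hle⟩ := hY2 (ξ + 1) (hδlim.add_one_lt hξδ)
    refine ⟨hξδ, g y, hTY ▸ ⟨y, hy, rfl⟩, ?_⟩
    rw [(hg y ((hY1 y hy).trans hδlam)).2]
    exact ⟨hξ, (Order.lt_add_one_iff.2 le_rfl).trans_le hle⟩
  · rintro ⟨hξδ, η, hη, hmem⟩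
    rw [hTY] at hη
    obtain ⟨y, hy, rfl⟩ := hη
    rw [(hg y ((hY1 y hy).trans hδlam)).2] at hmem
    exact ⟨hmem.1, hξδ⟩

end

/-- Shelah's diamond from instances of G.C.H. (Proposition 4.1). -/
theorem diamond_of_gch_instances
    (μ lam : Cardinal) (κ : Cardinal) (hκreg : κ.IsRegular) (hκμ : κ < μ)
    (hlam2 : lam = 2 ^ μ) (hlamsucc : lam = Order.succ μ)
    (hcases : μ ^ κ = μ ∨
      (ℵ₀ ≤ μ ∧ μ.ord.cof < μ ∧ μ.ord.cof ≠ κ ∧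
        ∀ d : Cardinal, d < μ → d ^ κ < μ)) :
    DiamondOn lam.ord {α : Ordinal | α < lam.ord ∧ α.cof = κ} := by
  exact diamond_aux μ lam κ hκreg hκμ hlam2 hlamsucc hcases
end

section
/- If λ = μ⁺ is a successor cardinal and E ⊆ λ is non-small (i.e. the weak diamond Φ_λ(E) holds), then E can be partitioned into λ pairwise disjoint subsets E = ⊔_{β<λ} E_β such that each E_β is non-small (Φ_λ(E_β) holds). -/
open Cardinal

/-- The weak diamond Φ_lam(E): for every family of partitions
`P ν : 𝒫(ν) → 2` there is a prediction function `φ : E → 2` such that for every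
`X ⊆ lam` the set `{ν ∈ E : P ν (X ∩ ν) = φ ν}` is stationary in `lam`.
A set `E` satisfying this is called non-small. -/
def WeakDiamondOn (lam : Ordinal) (E : Set Ordinal) : Prop :=
  ∀ P : Ordinal → Set Ordinal → Bool,
    ∃ φ : Ordinal → Bool,
      ∀ X : Set Ordinal, X ⊆ Set.Iio lam →
        IsStationaryIn lam {ν | ν ∈ E ∧ P ν (X ∩ Set.Iio ν) = φ ν}

/-- `g` is a monotone function below `L`. -/
def GoodFn (L : Ordinal) (g : Ordinal → Ordinal) : Prop :=
  (∀ x < L, g x < L) ∧ (∀ x y, x ≤ y → y < L → g x ≤ g y)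

theorem club_of_goodFn {L : Ordinal} (hc : ℵ₀ < L.cof) (hs : ∀ x < L, x + 1 < L)
    {g : Ordinal → Ordinal} (hg : GoodFn L g) :
    IsClubIn L {ν | ν < L ∧ 0 < ν ∧ ∀ x < ν, g x < ν} := by
  refine ⟨fun ν h => h.1, ?_, ?_⟩
  · intro β hβ
    let f : Ordinal → Ordinal := fun x => max (x + 1) (g x)
    have hf : ∀ x < L, f x < L := fun x hx => max_lt (hs x hx) (hg.1 x hx)
    have hlt : Ordinal.nfp f β < L := Ordinal.nfp_lt_ord hc hf hβ
    have hstep : ∀ n, f (f^[n] β) ≤ Ordinal.nfp f β := by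
      intro n
      have := Ordinal.iterate_le_nfp f β (n + 1)
      rwa [Function.iterate_succ_apply'] at this
    have hstep' : ∀ n, f^[n] β < Ordinal.nfp f β := by
      intro n
      refine lt_of_lt_of_le ?_ (hstep n)
      exact lt_of_lt_of_le (Order.lt_add_one_iff.2 le_rfl) (le_max_left _ _)
    refine ⟨Ordinal.nfp f β, ⟨hlt, ?_, ?_⟩, Ordinal.le_nfp f β⟩
    · exact lt_of_le_of_lt (zero_le) (hstep' 0)
    · intro x hx
      obtain ⟨n, hn⟩ := Ordinal.lt_nfp_iff.1 hx
      have h1 : g x ≤ g (f^[n] β) := hg.2 _ _ hn.le ((hstep' n).trans hlt)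
      have h2 : g (f^[n] β) ≤ f^[n+1] β := by
        rw [Function.iterate_succ_apply']; exact le_max_right _ _
      exact lt_of_le_of_lt (h1.trans h2) (hstep' (n+1))
  · intro s hsub hne hlt
    have hb : BddAbove s := ⟨L, fun x hx => (hsub hx).1.le⟩
    refine ⟨hlt, ?_, ?_⟩
    · obtain ⟨y, hy⟩ := hne
      exact lt_of_lt_of_le (hsub hy).2.1 (le_csSup hb hy)
    · intro x hx
      obtain ⟨y, hy, hxy⟩ := (lt_csSup_iff hb hne).1 hx
      exact lt_of_lt_of_le ((hsub hy).2.2 x hxy) (le_csSup hb hy)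

theorem goodFn_of_club {L : Ordinal} (hs : ∀ x < L, x + 1 < L) {C : Set Ordinal}
    (hC : IsClubIn L C) :
    ∃ g, GoodFn L g ∧ ∀ ν < L, 0 < ν → (∀ x < ν, g x < ν) → ν ∈ C := by
  have hne : ∀ x < L, {c | c ∈ C ∧ x < c}.Nonempty := by
    intro x hx
    obtain ⟨c, hc, hxc⟩ := hC.2.1 (x+1) (hs x hx)
    exact ⟨c, hc, lt_of_lt_of_le (Order.lt_add_one_iff.2 le_rfl) hxc⟩
  have hmem : ∀ x < L, sInf {c | c ∈ C ∧ x < c} ∈ {c | c ∈ C ∧ x < c} :=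
    fun x hx => csInf_mem (hne x hx)
  refine ⟨fun x => sInf {c | c ∈ C ∧ x < c}, ⟨fun x hx => hC.1 (hmem x hx).1, ?_⟩, ?_⟩
  · intro x y hxy hy
    exact csInf_le' ⟨(hmem y hy).1, lt_of_le_of_lt hxy (hmem y hy).2⟩
  · intro ν hν h0 hcl
    let s : Set Ordinal := {c | c ∈ C ∧ c < ν}
    have hsn : s.Nonempty := ⟨_, (hmem 0 (h0.trans hν)).1, hcl 0 h0⟩
    have hb : BddAbove s := ⟨ν, fun x hx => hx.2.le⟩
    have hsup : sSup s = ν := by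
      apply le_antisymm
      · exact csSup_le hsn fun x hx => hx.2.le
      · by_contra! hlt
        have hm := hmem _ (hlt.trans hν)
        have := le_csSup hb (show _ ∈ s from ⟨hm.1, hcl _ hlt⟩)
        exact absurd hm.2 (not_lt.2 this)
    have := hC.2.2 s (fun x hx => hx.1) hsn (hsup ▸ hν)
    rwa [hsup] at this

theorem union_lemma {μ lam : Cardinal} (hμ : ℵ₀ ≤ μ) (hlam : lam = Order.succ μ)
    (E : Set Ordinal) (hEns : WeakDiamondOn lam.ord E)
    (β : Ordinal) (hβ : β < lam.ord) (F : μ.ord.ToType → Set Ordinal)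
    (hF : ∀ ν ∈ E, β < ν → ∃ i, ν ∈ F i) : ∃ i, WeakDiamondOn lam.ord (F i) := by
  classical
  have hreg : lam.IsRegular := hlam ▸ isRegular_succ hμ
  have hcof : lam.ord.cof = lam := hreg.cof_ord
  have hμlam : μ < lam := hlam ▸ Order.lt_succ μ
  have hinf : ℵ₀ ≤ lam := hμ.trans hμlam.le
  have hadd := Ordinal.isPrincipal_add_ord hinf
  have hmul := Ordinal.isPrincipal_mul_ord hinf
  have hμo : μ.ord < lam.ord := ord_lt_ord.2 hμlam
  have hμ0 : μ.ord ≠ 0 := by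
    rw [Ne, ord_eq_zero]; exact (aleph0_pos.trans_le hμ).ne'
  have hs : ∀ x < lam.ord, x + 1 < lam.ord := fun x hx =>
    hadd hx (lt_of_le_of_lt (Order.one_le_iff_ne_zero.2 hμ0) hμo)
  have hc : ℵ₀ < lam.ord.cof := by rw [hcof]; exact lt_of_le_of_lt hμ hμlam
  by_contra! hcon
  simp only [WeakDiamondOn] at hcon
  push Not at hcon
  choose P hP using hcon
  obtain ⟨i0⟩ : Nonempty μ.ord.ToType := Ordinal.nonempty_toType_iff.2 hμ0
  let e : μ.ord.ToType → Ordinal := fun i => (Ordinal.ToType.mk.symm i).1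
  have he : ∀ i, e i < μ.ord := fun i => (Ordinal.ToType.mk.symm i).2
  have hinj : Function.Injective e := fun i j h =>
    Ordinal.ToType.mk.symm.injective (Subtype.ext h)
  let idx : Ordinal → μ.ord.ToType := fun ν => if h : ∃ i, ν ∈ F i then h.choose else i0
  have hidx : ∀ ν, (∃ i, ν ∈ F i) → ν ∈ F (idx ν) := by
    intro ν h
    simp only [idx, dif_pos h]
    exact h.choose_spec
  obtain ⟨φ, hφ⟩ := hEns (fun ν Y => P (idx ν) ν {x | x < ν ∧ μ.ord * x + e (idx ν) ∈ Y})
  choose X hX hXs using fun i => hP i φ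
  simp only [IsStationaryIn] at hXs
  push Not at hXs
  choose C hC hCe using hXs
  choose g hg hgC using fun i => goodFn_of_club hs (hC i)
  let Y : Set Ordinal := {y | ∃ i, ∃ x ∈ X i, y = μ.ord * x + e i}
  have hY : Y ⊆ Set.Iio lam.ord := by
    rintro y ⟨i, x, hx, rfl⟩
    exact hadd (hmul hμo (hX i hx)) ((he i).trans hμo)
  let G : Ordinal → Ordinal := fun x => max β (max (μ.ord * x + μ.ord) (⨆ i, g i x))
  have hG : GoodFn lam.ord G := by
    constructor
    · intro x hx
      refine max_lt hβ (max_lt (hadd (hmul hμo hx) hμo) ?_)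
      apply Ordinal.iSup_lt_of_lt_cof
      · rw [hcof, mk_ord_toType]; exact hμlam
      · exact fun i => (hg i).1 x hx
    · intro x y hxy hy
      refine max_le_max le_rfl (max_le_max ?_ ?_)
      · gcongr
      · exact Ordinal.iSup_le fun i => ((hg i).2 x y hxy hy).trans
          (Ordinal.le_iSup (fun i => g i y) i)
  obtain ⟨ν, ⟨hνE, hνφ⟩, hνL, hν0, hνG⟩ := hφ Y hY _ (club_of_goodFn hc hs hG)
  have hβν : β < ν := lt_of_le_of_lt (le_max_left _ _) (hνG 0 hν0)
  have hmem := hidx ν (hF ν hνE hβν)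
  generalize idx ν = i at hνφ hmem
  have hset : {x | x < ν ∧ μ.ord * x + e i ∈ Y ∩ Set.Iio ν} = X i ∩ Set.Iio ν := by
    ext x
    constructor
    · rintro ⟨hx, ⟨j, x', hx', heq⟩, -⟩
      have hd := congrArg (· / μ.ord) heq
      have hm := congrArg (· % μ.ord) heq
      simp only [Ordinal.mul_add_div _ hμ0, Ordinal.div_eq_zero_of_lt (he _), add_zero] at hd
      simp only [Ordinal.mul_add_mod_self, Ordinal.mod_eq_of_lt (he _)] at hm
      have := hinj hm
      subst this
      subst hd
      exact ⟨hx', hx⟩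
    · rintro ⟨hx, hxν⟩
      refine ⟨hxν, ⟨i, x, hx, rfl⟩, ?_⟩
      refine lt_of_lt_of_le ?_ (hνG x hxν).le
      refine lt_of_lt_of_le ?_ ((le_max_left _ _).trans (le_max_right _ _))
      gcongr
      exact he i
  simp only [hset] at hνφ
  have hνC : ν ∈ C i := by
    apply hgC i ν hνL hν0
    intro x hx
    refine lt_of_le_of_lt ?_ (hνG x hx)
    exact (Ordinal.le_iSup (fun i => g i x) i).trans ((le_max_right _ _).trans (le_max_right _ _))
  have : ν ∈ ({ν | ν ∈ F i ∧ P i ν (X i ∩ Set.Iio ν) = φ ν} ∩ C i) := ⟨⟨hmem, hνφ⟩, hνC⟩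
  rw [hCe i] at this
  exact this

theorem WeakDiamondOn.mono' {L : Ordinal} {A B : Set Ordinal} (h : A ⊆ B)
    (hA : WeakDiamondOn L A) : WeakDiamondOn L B := by
  intro P
  obtain ⟨φ, hφ⟩ := hA P
  refine ⟨φ, fun X hX C hC => ?_⟩
  obtain ⟨ν, ⟨h1, h2⟩, h3⟩ := hφ X hX C hC
  exact ⟨ν, ⟨h h1, h2⟩, h3⟩

/-- Decomposition of a non-small set into λ non-small pieces (Proposition 4.3). -/
theorem nonsmall_decomposition
    (μ lam : Cardinal) (hμ : ℵ₀ ≤ μ) (hlam : lam = Order.succ μ)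
    (E : Set Ordinal) (hE : E ⊆ Set.Iio lam.ord)
    (hEns : WeakDiamondOn lam.ord E) :
    ∃ Eb : Ordinal → Set Ordinal,
      (∀ β : Ordinal, β < lam.ord → Eb β ⊆ E) ∧
      (∀ β γ : Ordinal, β < lam.ord → γ < lam.ord → β ≠ γ →
        Eb β ∩ Eb γ = ∅) ∧
      (⋃ β ∈ Set.Iio lam.ord, Eb β) = E ∧
      (∀ β : Ordinal, β < lam.ord → WeakDiamondOn lam.ord (Eb β)) := by
  classical
  have hreg : lam.IsRegular := hlam ▸ isRegular_succ hμ
  have hcof : lam.ord.cof = lam := hreg.cof_ord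
  have hμlam : μ < lam := hlam ▸ Order.lt_succ μ
  have hinf : ℵ₀ ≤ lam := hμ.trans hμlam.le
  have hL0 : 0 < lam.ord := by
    rw [pos_iff_ne_zero, Ne, ord_eq_zero]; exact (aleph0_pos.trans_le hinf).ne'
  have hμ0 : μ.ord ≠ 0 := by
    rw [Ne, ord_eq_zero]; exact (aleph0_pos.trans_le hμ).ne'
  obtain ⟨i0⟩ : Nonempty μ.ord.ToType := Ordinal.nonempty_toType_iff.2 hμ0
  have hf : ∀ α : Ordinal, ∃ f : Ordinal → μ.ord.ToType, α < lam.ord →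
      Set.InjOn f (Set.Iio α) := by
    intro α
    by_cases hα : α < lam.ord
    · have h1 : α.card ≤ μ := by
        rw [lt_ord, hlam] at hα
        exact Order.lt_succ_iff.1 hα
      have h2 : #α.ToType ≤ #μ.ord.ToType := by simpa using h1
      obtain ⟨k⟩ := h2
      refine ⟨fun x => if h : x < α then k (Ordinal.ToType.mk ⟨x, h⟩) else i0, fun _ => ?_⟩
      intro x hx y hy hxy
      simp only [dif_pos (show x < α from hx), dif_pos (show y < α from hy)] at hxy
      have := Ordinal.ToType.mk.injective (k.injective hxy)
      exact congrArg Subtype.val this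
    · exact ⟨fun _ => i0, fun h => absurd h hα⟩
  choose f hf using hf
  let A : Ordinal → μ.ord.ToType → Set Ordinal := fun β i => {α | α ∈ E ∧ β < α ∧ f α β = i}
  have hA : ∀ b : lam.ord.ToType, ∃ i, WeakDiamondOn lam.ord (A (Ordinal.ToType.mk.symm b).1 i) := by
    intro b
    exact union_lemma hμ hlam E hEns _ (Ordinal.ToType.mk.symm b).2 _
      fun ν hν hb => ⟨_, hν, hb, rfl⟩
  choose c hcA using hA
  obtain ⟨i, hi⟩ := infinite_pigeonhole c (by simpa using hinf)
    (by simp only [mk_ord_toType, hcof]; exact hμlam)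
  obtain ⟨q⟩ := Cardinal.eq.1 hi.symm
  let r : Ordinal → Ordinal := fun β =>
    if h : β < lam.ord then (Ordinal.ToType.mk.symm (q (Ordinal.ToType.mk ⟨β, h⟩)).1).1 else 0
  have hr : ∀ β < lam.ord, WeakDiamondOn lam.ord (A (r β) i) := by
    intro β hβ
    simp only [r, dif_pos hβ]
    have h1 := (q (Ordinal.ToType.mk ⟨β, hβ⟩)).2
    have h2 := hcA (q (Ordinal.ToType.mk ⟨β, hβ⟩)).1
    rw [show c _ = i from h1] at h2
    exact h2
  have hrinj : ∀ β γ, β < lam.ord → γ < lam.ord → r β = r γ → β = γ := by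
    intro β γ hβ hγ h
    simp only [r, dif_pos hβ, dif_pos hγ] at h
    have := Ordinal.ToType.mk.injective (q.injective (Subtype.ext
      (Ordinal.ToType.mk.symm.injective (Subtype.ext h))))
    exact congrArg Subtype.val this
  have hdisj : ∀ β γ ν, β < lam.ord → γ < lam.ord → ν ∈ A (r β) i → ν ∈ A (r γ) i → β = γ := by
    intro β γ ν hβ hγ h1 h2
    exact hrinj β γ hβ hγ (hf ν (hE h1.1) h1.2.1 h2.2.1 (h1.2.2.trans h2.2.2.symm))
  refine ⟨fun β => A (r β) i ∪
    {ν | β = 0 ∧ ν ∈ E ∧ ∀ γ < lam.ord, ν ∉ A (r γ) i}, ?_, ?_, ?_, ?_⟩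
  · rintro β hβ ν (h | h)
    · exact h.1
    · exact h.2.1
  · intro β γ hβ hγ hne
    rw [Set.eq_empty_iff_forall_notMem]
    rintro ν ⟨h1 | h1, h2 | h2⟩
    · exact hne (hdisj β γ ν hβ hγ h1 h2)
    · exact h2.2.2 β hβ h1
    · exact h1.2.2 γ hγ h2
    · exact hne (h1.1.trans h2.1.symm)
  · ext ν
    simp only [Set.mem_iUnion]
    constructor
    · rintro ⟨β, hβ, h | h⟩
      · exact h.1
      · exact h.2.1
    · intro hν
      by_cases h : ∃ γ < lam.ord, ν ∈ A (r γ) i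
      · obtain ⟨γ, hγ, h⟩ := h
        exact ⟨γ, hγ, Or.inl h⟩
      · push Not at h
        exact ⟨0, hL0, Or.inr ⟨rfl, hν, h⟩⟩
  · intro β hβ
    exact (hr β hβ).mono' Set.subset_union_left
end
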